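/- arXiv:2012.11771 — 4 statements merged into one kernel-verified Lean document; each statement's English description precedes it below -/
import Mathlib

section
/- Let R be a commutative ring, λ ∈ R a non-zero-divisor, and a ∈ R. Let X be a faithful R-module generated by two elements x and y satisfying λ·y = a·x. Then there is a well-defined R-linear map α : X → R with α(x) = λ and α(y) = a, and, letting β : R → X be the R-linear map with β(1) = x, the compositions satisfy α ∘ β = λ·id on R and β ∘ α = λ·id on X. In particular the annihilator of x in R is zero. -/
/-- Let `R` be a commutative ring, `l ∈ R` a non-zero-divisor, `a ∈ R`, and let `X` be a
faithful `R`-module generated by two elements `x, y` with `l • y = a • x`.  Then there is a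
well-defined `R`-linear map `α : X → R` with `α x = l`, `α y = a`, and, with
`β : R → X` the `R`-linear map sending `1` to `x`, we have `α ∘ β = l • id` on `R` and
`β ∘ α = l • id` on `X`.  In particular the annihilator of `x` in `R` is zero. -/
theorem exists_pseudoIsogeny_of_two_generators
    (R : Type*) [CommRing R] (l a : R) (hl : l ∈ nonZeroDivisors R)
    (X : Type*) [AddCommGroup X] [Module R X]
    (hfaithful : ∀ r : R, (∀ z : X, r • z = 0) → r = 0)
    (x y : X) (hgen : Submodule.span R ({x, y} : Set X) = ⊤)
    (hrel : l • y = a • x) :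
    ∃ α : X →ₗ[R] R, α x = l ∧ α y = a ∧
      α ∘ₗ LinearMap.toSpanSingleton R X x = l • (LinearMap.id : R →ₗ[R] R) ∧
      (LinearMap.toSpanSingleton R X x) ∘ₗ α = l • (LinearMap.id : X →ₗ[R] X) ∧
      ∀ r : R, r • x = 0 → r = 0 := by
  have hann : ∀ r : R, r • x = 0 → r = 0 := by
    intro r hr
    refine (mul_left_mem_nonZeroDivisors_eq_zero_iff hl).1 (hfaithful _ fun z => ?_)
    obtain ⟨c, d, rfl⟩ := Submodule.mem_span_pair.1 (hgen ▸ Submodule.mem_top : z ∈ _)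
    have hy : (l * r) • y = 0 := by
      rw [mul_comm, mul_smul, hrel, smul_comm, hr, smul_zero]
    rw [smul_add, smul_comm _ c, smul_comm _ d, hy, mul_smul, hr]
    simp
  set β := LinearMap.toSpanSingleton R X x with hβ
  have hβ_apply : ∀ r : R, β r = r • x := fun _ => rfl
  have hinj : Function.Injective β :=
    (injective_iff_map_eq_zero β).2 hann
  have hrange : ∀ z : X, (l • (LinearMap.id : X →ₗ[R] X)) z ∈ LinearMap.range β := by
    intro z
    obtain ⟨c, d, rfl⟩ := Submodule.mem_span_pair.1 (hgen ▸ Submodule.mem_top : z ∈ _)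
    refine ⟨c * l + d * a, ?_⟩
    simp only [hβ_apply, LinearMap.smul_apply, LinearMap.id_apply]
    rw [smul_add, smul_comm l c, smul_comm l d, hrel, add_smul, mul_smul, mul_smul]
  let α : X →ₗ[R] R := (LinearEquiv.ofInjective β hinj).symm.toLinearMap ∘ₗ
    (l • (LinearMap.id : X →ₗ[R] X)).codRestrict (LinearMap.range β) hrange
  have hβα : ∀ z, β (α z) = l • z := fun z =>
    congrArg Subtype.val ((LinearEquiv.ofInjective β hinj).apply_symm_apply
      ((l • (LinearMap.id : X →ₗ[R] X)).codRestrict (LinearMap.range β) hrange z))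
  have hx : α x = l := hinj (hβα x)
  refine ⟨α, hx, hinj ((hβα y).trans hrel), ?_, LinearMap.ext hβα, hann⟩
  ext
  simp [hβ, hx]
end

section
/- Let k be a finite field and let G be a subgroup of GL₂(k) containing SL₂(k). Suppose there exists g₀ ∈ G with (det g₀)² ≠ 1. Then there exists a matrix A ∈ G such that det A ≠ 1 and tr A ≠ det A + 1. -/
/-- Let `k` be a finite field and `G ≤ GL₂(k)` a subgroup containing `SL₂(k)`.
If some `g₀ ∈ G` has `(det g₀)² ≠ 1`, then there is `A ∈ G` with `det A ≠ 1` and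
`tr A ≠ det A + 1`. -/
theorem exists_trace_ne_det_add_one (k : Type*) [Field k] [Finite k]
    (G : Subgroup (GL (Fin 2) k))
    (hSL : ∀ A : GL (Fin 2) k, Matrix.det (A : Matrix (Fin 2) (Fin 2) k) = 1 → A ∈ G)
    (hg₀ : ∃ g₀ ∈ G, (Matrix.det ((g₀ : GL (Fin 2) k) : Matrix (Fin 2) (Fin 2) k)) ^ 2 ≠ 1) :
    ∃ A ∈ G, Matrix.det ((A : GL (Fin 2) k) : Matrix (Fin 2) (Fin 2) k) ≠ 1 ∧
      Matrix.trace ((A : GL (Fin 2) k) : Matrix (Fin 2) (Fin 2) k) ≠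
        Matrix.det ((A : GL (Fin 2) k) : Matrix (Fin 2) (Fin 2) k) + 1 := by
  obtain ⟨g₀, hg, hd⟩ := hg₀
  set d := Matrix.det (g₀ : Matrix (Fin 2) (Fin 2) k) with hdef
  have hd0 : d ≠ 0 := g₀.det_ne_zero
  have hdet : Matrix.det !![0, -d; 1, 0] = d := by simp [Matrix.det_fin_two_of]
  let B : GL (Fin 2) k :=
    Matrix.GeneralLinearGroup.mkOfDetNeZero !![0, -d; 1, 0] (by rwa [hdet])
  have hB : (B : Matrix (Fin 2) (Fin 2) k) = !![0, -d; 1, 0] := rfl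
  refine ⟨B, ?_, ?_, ?_⟩
  · have h : B * g₀⁻¹ ∈ G := hSL _ (by
      rw [Units.val_mul, Matrix.det_mul, hB, hdet, hdef, ← Matrix.det_mul, Units.mul_inv,
        Matrix.det_one])
    simpa using G.mul_mem h hg
  · rw [hB, hdet]
    rintro h
    simp [h] at hd
  · rw [hB, hdet, Matrix.trace_fin_two_of]
    intro h
    exact hd (by linear_combination (1 - d) * h)
end

section
/- Let R be a commutative ring, X an R-module, and t, q, μ ∈ R with μ² = 1. Define the R-linear endomorphism U of X ⊕ X by U(x₁, x₂) = (t·x₁ + q·x₂, −x₁). Then the map x ↦ (x, 0) induces an isomorphism of R-modules X/((t − μ(q+1))·X) ≅ (X ⊕ X)/((U − μ)(X ⊕ X)). -/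
/-- Let `R` be a commutative ring, `X` an `R`-module, and `t, q, μ ∈ R` with `μ² = 1`.
Let `U` be the `R`-linear endomorphism of `X ⊕ X` given by
`U (x₁, x₂) = (t•x₁ + q•x₂, −x₁)`.  Then `x ↦ (x, 0)` induces an isomorphism of `R`-modules
`X/((t − μ(q+1))·X) ≃ (X ⊕ X)/((U − μ)(X ⊕ X))`. -/
theorem quotient_iso_of_Uq_action (R : Type*) [CommRing R]
    (X : Type*) [AddCommGroup X] [Module R X]
    (t q μ : R) (hμ : μ ^ 2 = 1)
    (U : (X × X) →ₗ[R] X × X)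
    (hU : ∀ z : X × X, U z = (t • z.1 + q • z.2, -z.1)) :
    ∃ e : (X ⧸ LinearMap.range ((t - μ * (q + 1)) • (LinearMap.id : X →ₗ[R] X))) ≃ₗ[R]
        ((X × X) ⧸ LinearMap.range (U - μ • (LinearMap.id : (X × X) →ₗ[R] X × X))),
      ∀ x : X, e (Submodule.Quotient.mk x) = Submodule.Quotient.mk (x, (0 : X)) := by
  set c : R := t - μ * (q + 1) with hc
  have hUμ (z : X × X) : (U - μ • (LinearMap.id : (X × X) →ₗ[R] X × X)) z =
      ((t - μ) • z.1 + q • z.2, -z.1 - μ • z.2) := by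
    simp only [LinearMap.sub_apply, LinearMap.smul_apply, LinearMap.id_apply, hU]
    ext <;> simp only [Prod.fst_sub, Prod.snd_sub, Prod.smul_fst, Prod.smul_snd]
    module
  have hinl : LinearMap.range (c • (LinearMap.id : X →ₗ[R] X)) ≤
      (LinearMap.range (U - μ • (LinearMap.id : (X × X) →ₗ[R] X × X))).comap
        (LinearMap.inl R X X) := by
    rintro _ ⟨y, rfl⟩
    refine ⟨(y, -μ • y), ?_⟩
    rw [hUμ]
    ext
    · simp only [LinearMap.smul_apply, LinearMap.id_apply, LinearMap.inl_apply, hc]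
      module
    · simp only [LinearMap.inl_apply]
      linear_combination (norm := module) hμ • y
  have hretract : LinearMap.range (U - μ • (LinearMap.id : (X × X) →ₗ[R] X × X)) ≤
      (LinearMap.range (c • (LinearMap.id : X →ₗ[R] X))).comap
        (LinearMap.coprod LinearMap.id ((t - μ) • LinearMap.id)) := by
    rintro _ ⟨z, rfl⟩
    refine ⟨-μ • z.2, ?_⟩
    rw [hUμ]
    simp only [LinearMap.coprod_apply, LinearMap.smul_apply, LinearMap.id_apply, hc]
    linear_combination (norm := module) (q * hμ) • z.2
  refine ⟨LinearEquiv.ofLinearMap (Submodule.mapQ _ _ _ hinl) (Submodule.mapQ _ _ _ hretract)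
    ?_ ?_, fun x => rfl⟩
  · refine Submodule.linearMap_qext _ (LinearMap.ext fun z => ?_)
    refine (Submodule.Quotient.eq _).2 ⟨(z.2, 0), ?_⟩
    rw [hUμ]
    ext <;> simp
  · refine Submodule.linearMap_qext _ (LinearMap.ext fun x => ?_)
    refine congrArg Submodule.Quotient.mk ?_
    simp
end

section
/- Let p be a prime, M ≥ 1, and 1 ≤ r ≤ M. Let G be a group and let A be a G-module whose underlying abelian group is a free ℤ/p^Mℤ-module of finite rank, with G acting by ℤ/p^M-linear automorphisms. Suppose that for every 1 ≤ s ≤ M the fixed submodule (A/p^s A)^G is zero. Then the inclusion A[p^r] ⊆ A induces an isomorphism from H¹(G, A[p^r]) onto the p^r-torsion subgroup H¹(G, A)[p^r] of H¹(G, A). -/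
/-- The group of 1-cocycles of `G` with values in the `G`-module `A`. -/
def oneCocycles (G A : Type*) [Group G] [AddCommGroup A] [DistribMulAction G A] :
    AddSubgroup (G → A) where
  carrier := {c | ∀ g h : G, c (g * h) = c g + g • c h}
  zero_mem' := by intro g h; simp
  add_mem' := by
    intro c d hc hd g h
    simp only [Pi.add_apply, hc g h, hd g h, smul_add]
    abel
  neg_mem' := by
    intro c hc g h
    simp only [Pi.neg_apply, hc g h, smul_neg]
    abel

/-- The group of 1-coboundaries of `G` with values in the `G`-module `A`. -/
def oneCoboundaries (G A : Type*) [Group G] [AddCommGroup A] [DistribMulAction G A] :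
    AddSubgroup (G → A) where
  carrier := {c | ∃ a : A, ∀ g : G, c g = g • a - a}
  zero_mem' := ⟨0, by simp⟩
  add_mem' := by
    rintro c d ⟨a, ha⟩ ⟨b, hb⟩
    refine ⟨a + b, fun g => ?_⟩
    simp only [Pi.add_apply, ha g, hb g, smul_add]
    abel
  neg_mem' := by
    rintro c ⟨a, ha⟩
    refine ⟨-a, fun g => ?_⟩
    simp only [Pi.neg_apply, ha g, smul_neg]
    abel

/-- First group cohomology `H¹(G, A)`, defined as 1-cocycles modulo 1-coboundaries. -/
abbrev H1 (G A : Type*) [Group G] [AddCommGroup A] [DistribMulAction G A] :=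
  oneCocycles G A ⧸ (oneCoboundaries G A).addSubgroupOf (oneCocycles G A)

section Functoriality

variable {G A B : Type*} [Group G] [AddCommGroup A] [DistribMulAction G A]
  [AddCommGroup B] [DistribMulAction G B]

/-- Postcomposition of 1-cocycles with an equivariant homomorphism. -/
def oneCocyclesMap (f : B →+ A) (hf : ∀ (g : G) (x : B), f (g • x) = g • f x) :
    oneCocycles G B →+ oneCocycles G A where
  toFun c := ⟨f ∘ (c : G → B), fun g h => by simp [c.2 g h, hf]⟩
  map_zero' := by ext; simp
  map_add' c d := by ext; simp

theorem oneCocyclesMap_apply (f : B →+ A) (hf : ∀ (g : G) (x : B), f (g • x) = g • f x)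
    (c : oneCocycles G B) (g : G) :
    (oneCocyclesMap f hf c : G → A) g = f ((c : G → B) g) :=
  rfl

/-- The homomorphism on first cohomology induced by an equivariant homomorphism. -/
def H1map (f : B →+ A) (hf : ∀ (g : G) (x : B), f (g • x) = g • f x) : H1 G B →+ H1 G A :=
  QuotientAddGroup.map _ _ (oneCocyclesMap f hf) <| by
    rintro c ⟨b, hb⟩
    refine ⟨f b, fun g => ?_⟩
    have h := congrArg f (hb g)
    rwa [map_sub, hf] at h

theorem H1map_mk (f : B →+ A) (hf : ∀ (g : G) (x : B), f (g • x) = g • f x)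
    (c : oneCocycles G B) :
    H1map f hf (QuotientAddGroup.mk c) = QuotientAddGroup.mk (oneCocyclesMap f hf c) :=
  rfl

theorem H1_mk_eq_zero_iff (c : oneCocycles G A) :
    (QuotientAddGroup.mk c : H1 G A) = 0 ↔ ∃ a : A, ∀ g : G, (c : G → A) g = g • a - a :=
  QuotientAddGroup.eq_zero_iff c

/-- If `A` has no nonzero invariants, the inclusion of its `n`-torsion is injective on `H¹`. -/
theorem H1map_injective_of_range_torsion (n : ℕ) (f : B →+ A)
    (hf : ∀ (g : G) (x : B), f (g • x) = g • f x) (hinj : Function.Injective f)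
    (hrange : ∀ x : A, (∃ y, f y = x) ↔ n • x = 0)
    (hinv : ∀ x : A, (∀ g : G, g • x = x) → x = 0) :
    Function.Injective (H1map f hf) := by
  refine (injective_iff_map_eq_zero _).2 fun x hx => ?_
  obtain ⟨c, rfl⟩ := QuotientAddGroup.mk_surjective x
  rw [H1map_mk, H1_mk_eq_zero_iff] at hx
  obtain ⟨a, ha⟩ := hx
  obtain ⟨b, rfl⟩ := (hrange a).2 <| hinv _ fun g => by
    have h := (hrange _).1 ⟨_, ha g⟩
    rwa [smul_sub, smul_comm n g a, sub_eq_zero] at h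
  refine (H1_mk_eq_zero_iff c).2 ⟨b, fun g => hinj ?_⟩
  rw [map_sub, hf]
  exact ha g

/-- If `A / n` has no nonzero invariants, the inclusion of the `n`-torsion of `A` maps `H¹` onto
the `n`-torsion of `H¹(G, A)`. -/
theorem mem_range_H1map_iff_of_range_torsion (n : ℕ) (f : B →+ A)
    (hf : ∀ (g : G) (x : B), f (g • x) = g • f x) (hinj : Function.Injective f)
    (hrange : ∀ x : A, (∃ y, f y = x) ↔ n • x = 0)
    (hinv : ∀ x : A, (∀ g : G, ∃ y, g • x - x = n • y) → ∃ y, x = n • y) (x : H1 G A) :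
    x ∈ Set.range (H1map f hf) ↔ n • x = 0 := by
  constructor
  · rintro ⟨z, rfl⟩
    obtain ⟨c, rfl⟩ := QuotientAddGroup.mk_surjective z
    rw [H1map_mk, ← QuotientAddGroup.mk_nsmul, H1_mk_eq_zero_iff]
    refine ⟨0, fun g => ?_⟩
    rw [smul_zero, sub_zero]
    exact (hrange _).1 ⟨_, rfl⟩
  · obtain ⟨c, rfl⟩ := QuotientAddGroup.mk_surjective x
    intro hx
    rw [← QuotientAddGroup.mk_nsmul, H1_mk_eq_zero_iff] at hx
    obtain ⟨b, hb⟩ := hx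
    obtain ⟨a, rfl⟩ := hinv b fun g => ⟨(c : G → A) g, (hb g).symm⟩
    have key (g : G) : ∃ y, f y = (c : G → A) g - (g • a - a) := by
      refine (hrange _).2 ?_
      have h : n • (c : G → A) g = g • n • a - n • a := hb g
      rw [smul_sub, smul_sub, h, smul_comm n g a, sub_self]
    choose d hd using key
    have hd_mem : d ∈ oneCocycles G B := fun g h => hinj <| by
      rw [map_add, hf, hd, hd, hd, c.2 g h, mul_smul, smul_sub, smul_sub]
      abel
    refine ⟨QuotientAddGroup.mk ⟨d, hd_mem⟩, ?_⟩
    rw [H1map_mk, ← sub_eq_zero, ← QuotientAddGroup.mk_sub, H1_mk_eq_zero_iff]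
    refine ⟨-a, fun g => ?_⟩
    change f (d g) - (c : G → A) g = _
    rw [hd, smul_neg]
    abel

end Functoriality

/-- Let `p` be a prime, `1 ≤ r ≤ M`, `G` a group and `A` a `G`-module which is a finite
free `ℤ/p^M`-module with `G` acting `ℤ/p^M`-linearly.  Assume `(A/p^s A)^G = 0` for all
`1 ≤ s ≤ M`.  If `ι : A' → A` is (a copy of) the inclusion of the `p^r`-torsion
`A[p^r] ⊆ A` (i.e. `ι` is an injective `G`-equivariant map with image the `p^r`-torsion of
`A`), then the map induced by `ι` is an isomorphism from `H¹(G, A[p^r])` onto the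
`p^r`-torsion subgroup `H¹(G, A)[p^r]` of `H¹(G, A)`. -/
theorem h1_torsion_isomorphism (p M r : ℕ) (hp : p.Prime) (hr1 : 1 ≤ r) (hrM : r ≤ M)
    (G : Type*) [Group G]
    (A : Type*) [AddCommGroup A] [Module (ZMod (p ^ M)) A]
    [Module.Free (ZMod (p ^ M)) A] [Module.Finite (ZMod (p ^ M)) A]
    [DistribMulAction G A] [SMulCommClass G (ZMod (p ^ M)) A]
    (hfix : ∀ s : ℕ, 1 ≤ s → s ≤ M → ∀ x : A,
      (∀ g : G, ∃ y : A, g • x - x = (p : ZMod (p ^ M)) ^ s • y) →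
      ∃ y : A, x = (p : ZMod (p ^ M)) ^ s • y)
    (A' : Type*) [AddCommGroup A'] [DistribMulAction G A']
    (ι : A' →+ A) (hinj : Function.Injective ι)
    (hequiv : ∀ (g : G) (x : A'), ι (g • x) = g • ι x)
    (hrange : ∀ x : A, (∃ x' : A', ι x' = x) ↔ (p : ZMod (p ^ M)) ^ r • x = 0) :
    ∃ Φ : H1 G A' →+ H1 G A,
      (∀ (c : oneCocycles G A') (hc : (⇑ι ∘ (c : G → A')) ∈ oneCocycles G A),
        Φ (QuotientAddGroup.mk c) = QuotientAddGroup.mk ⟨⇑ι ∘ (c : G → A'), hc⟩) ∧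
      Function.Injective Φ ∧
      (∀ x : H1 G A, x ∈ Set.range Φ ↔ p ^ r • x = 0) := by
  have hsmul (s : ℕ) (x : A) : (p : ZMod (p ^ M)) ^ s • x = p ^ s • x := by
    rw [← Nat.cast_pow, Nat.cast_smul_eq_nsmul]
  simp only [hsmul] at hfix hrange
  have htop (x : A) : p ^ M • x = 0 := by
    rw [← Nat.cast_smul_eq_nsmul (ZMod (p ^ M)), ZMod.natCast_self, zero_smul]
  refine ⟨H1map ι hequiv, fun _ _ => rfl,
    H1map_injective_of_range_torsion _ ι hequiv hinj hrange fun x hx => ?_,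
    mem_range_H1map_iff_of_range_torsion _ ι hequiv hinj hrange (hfix r hr1 hrM)⟩
  obtain ⟨y, rfl⟩ := hfix M (hr1.trans hrM) le_rfl x fun g => ⟨0, by simp [hx g]⟩
  exact htop y
end
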